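/- Let N ≥ 0. For a ∈ ℝ define B_{N+1}(x; a) = det(x·I_{N+1} + ℬ_{N+1}(a)), where ℬ_{N+1}(a) is the (N+1)×(N+1) tridiagonal matrix with diagonal entries −n, superdiagonal entries (i+1)a, and subdiagonal entries (N−i+1)(a−1) (0-indexed), and define D_{N+1}(x) = det(x·I_{N+1} + 𝒟_{N+1}), where 𝒟_{N+1} has zero diagonal, superdiagonal entries i+1, and subdiagonal entries N−i+1. Then for every real x, B_{N+1}(ax; a)/a^{N+1} tends to D_{N+1}(x) as a → ∞. -/

import Mathlib

/-- The Sylvester matrix `𝒟_{N+1}` of size `n = N + 1`: zero diagonal,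
superdiagonal entries `i + 1`, subdiagonal entries `N - i + 1 = n - i` (0-indexed). -/
def sylvesterD (n : ℕ) : Matrix (Fin n) (Fin n) ℝ :=
  Matrix.of fun i j =>
    if (j : ℕ) = (i : ℕ) + 1 then ((i : ℕ) + 1 : ℝ)
    else if (i : ℕ) = (j : ℕ) + 1 then ((n : ℝ) - (i : ℕ))
    else 0

/-- Askey's matrix `ℬ_{N+1}(a)` of size `n = N + 1`: diagonal entries `-i`,
superdiagonal entries `(i + 1) a`, subdiagonal entries `(N - i + 1)(a - 1) = (n - i)(a - 1)`
(0-indexed). -/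
def askeyB (n : ℕ) (a : ℝ) : Matrix (Fin n) (Fin n) ℝ :=
  Matrix.of fun i j =>
    if (j : ℕ) = (i : ℕ) + 1 then ((i : ℕ) + 1 : ℝ) * a
    else if (i : ℕ) = (j : ℕ) + 1 then ((n : ℝ) - (i : ℕ)) * (a - 1)
    else if i = j then -((i : ℕ) : ℝ)
    else 0

/-- Askey's matrix is affine in its parameter, with slope the Sylvester matrix. -/
theorem askeyB_eq_smul_sylvesterD_add (n : ℕ) (a : ℝ) :
    askeyB n a = a • sylvesterD n + askeyB n 0 := by
  ext i j
  simp only [askeyB, sylvesterD, Matrix.of_apply, Matrix.add_apply, Matrix.smul_apply, smul_eq_mul]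
  split_ifs <;> ring

/-- If `a • A + E` is rescaled by `a`, its determinant tends to that of `A` as `a → ∞`. -/
theorem tendsto_det_smul_add_div_pow {n : ℕ} (A E : Matrix (Fin n) (Fin n) ℝ) :
    Filter.Tendsto (fun a : ℝ => (a • A + E).det / a ^ n) Filter.atTop (nhds A.det) := by
  have hlim : Filter.Tendsto (fun a : ℝ => A + a⁻¹ • E) Filter.atTop (nhds A) := by
    simpa using ((tendsto_inv_atTop_zero (𝕜 := ℝ)).smul_const E).const_add A
  refine ((continuous_id.matrix_det.tendsto A).comp hlim).congr' ?_
  filter_upwards [Filter.eventually_ne_atTop 0] with a ha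
  have hfactor : a • A + E = a • (A + a⁻¹ • E) := by
    rw [smul_add, smul_inv_smul₀ ha]
  rw [hfactor, Matrix.det_smul, Fintype.card_fin, mul_div_cancel_left₀ _ (pow_ne_zero n ha)]
  rfl

theorem askeyB_tendsto_sylvester (N : ℕ) (x : ℝ) :
    Filter.Tendsto
      (fun a : ℝ =>
        ((a * x) • (1 : Matrix (Fin (N + 1)) (Fin (N + 1)) ℝ) + askeyB (N + 1) a).det /
          a ^ (N + 1))
      Filter.atTop
      (nhds ((x • (1 : Matrix (Fin (N + 1)) (Fin (N + 1)) ℝ) + sylvesterD (N + 1)).det) ) := by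
  refine (tendsto_det_smul_add_div_pow (x • 1 + sylvesterD (N + 1)) (askeyB (N + 1) 0)).congr
    fun a => ?_
  rw [askeyB_eq_smul_sylvesterD_add (N + 1) a, smul_add, smul_smul, add_assoc]
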